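/- For all n ≥ 1 and 2 ≤ k ≤ n, the number a_k(n) of permutations of [n] whose longest alternating subsequence has length k satisfies a_k(n) = k·a_k(n-1) + a_{k-1}(n-1) + (n-k+1)·a_{k-2}(n-1), with initial values a_0(0) = a_1(1) = 1 and a_k(0) = a_0(n) = 0 for n, k ≥ 1. -/

import Mathlib

open Finset Polynomial

/-- `pval π i` is the value `π(i+1)` of the permutation in one-based value convention
(values `1,…,n`), and `0` for indices out of range. -/
def pval {n : ℕ} (π : Equiv.Perm (Fin n)) (i : ℕ) : ℕ :=
  if h : i < n then (π ⟨i, h⟩ : ℕ) + 1 else 0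

/-- `altOK d l` : the list `l` is alternating, starting with a descent iff `d = true`. -/
def altOK : Bool → List ℕ → Bool
  | _, [] => true
  | _, [_] => true
  | d, a :: b :: t => (if d then decide (b < a) else decide (a < b)) && altOK (!d) (b :: t)

/-- length of the longest alternating (down-up-down-…) subsequence of a list -/
def las (l : List ℕ) : ℕ :=
  ((l.sublists.filter (altOK true)).map List.length).foldr max 0

/-- `a_k(n)` (written `anum n k`): the number of permutations of `[n]` whose longest
alternating subsequence has length `k`. -/
def anum (n k : ℕ) : ℕ :=
  (Finset.univ.filter (fun π : Equiv.Perm (Fin n) =>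
    las (List.ofFn (fun i : Fin n => pval π (i : ℕ))) = k)).card

/-- The number of changes of direction met when reading `l` after the value `a`, the current
direction being ascending iff `d = true`. -/
def turns : Bool → ℕ → List ℕ → ℕ
  | _, _, [] => 0
  | d, a, b :: l => if decide (a < b) = d then turns d b l else turns (!d) b l + 1

theorem turns_le_length (d : Bool) (a : ℕ) (l : List ℕ) : turns d a l ≤ l.length := by
  induction l generalizing d a with
  | nil => simp [turns]
  | cons b l ih =>
    have h₁ := ih d b
    have h₂ := ih (!d) b
    simp only [turns, List.length_cons]
    split_ifs <;> omega

theorem turns_le_turns_not_add_one (d : Bool) (a : ℕ) (l : List ℕ) :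
    turns d a l ≤ turns (!d) a l + 1 := by
  induction l generalizing d a with
  | nil => simp [turns]
  | cons b l ih =>
    have h := ih d b
    by_cases hab : a < b <;> cases d <;> simp [turns, hab] at * <;> omega

theorem length_le_turns_of_altOK {d : Bool} {a : ℕ} {l s : List ℕ} (hs : s.Sublist (a :: l))
    (hd : altOK d s = true) : s.length ≤ turns d a l + 1 := by
  induction l generalizing d a s with
  | nil => simpa [turns] using hs.length_le
  | cons b l ih =>
    cases hs with
    | cons _ h =>
      have h₁ := ih h hd
      have h₂ := turns_le_turns_not_add_one d b l
      simp only [turns]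
      split_ifs <;> omega
    | @cons_cons s' _ _ h =>
      match s', h, hd with
      | [], _, _ => simp
      | c :: t, h, hd =>
        simp only [altOK, Bool.and_eq_true] at hd
        obtain ⟨hc, ht⟩ := hd
        simp only [turns]
        split_ifs with hab
        · have hcb : c ≠ b := by
            rintro rfl
            cases d <;> simp at hc hab <;> omega
          have hsub : (c :: t).Sublist l := by
            cases h with
            | cons _ h => exact h
            | cons_cons _ h => exact absurd rfl hcb
          have := ih (d := d) (s := b :: c :: t) (hsub.cons_cons b) (by
            simp only [altOK, ht, Bool.and_true]
            cases d <;> simp at hc hab ⊢ <;> omega)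
          simpa using this
        · have := ih h ht
          simp at this ⊢
          omega

theorem exists_altOK_length_eq {d : Bool} {a : ℕ} {l : List ℕ} (hl : (a :: l).Nodup) :
    ∃ c t, (c :: t).Sublist (a :: l) ∧ altOK d (c :: t) = true ∧
      (c :: t).length = turns d a l + 1 ∧ (if d then a ≤ c else c ≤ a) := by
  induction l generalizing d a with
  | nil => exact ⟨a, [], by simp, by simp [altOK], by simp [turns], by simp⟩
  | cons b l ih =>
    have hne : a ≠ b := by
      rintro rfl
      simp at hl
    have hl' := (List.nodup_cons.1 hl).2
    by_cases hab : decide (a < b) = d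
    · obtain ⟨c, t, h₁, h₂, h₃, h₄⟩ := ih (d := d) hl'
      refine ⟨c, t, h₁.cons a, h₂, by simp [turns, hab, h₃], ?_⟩
      cases d <;> simp at hab h₄ ⊢ <;> omega
    · obtain ⟨c, t, h₁, h₂, h₃, h₄⟩ := ih (d := !d) hl'
      refine ⟨a, c :: t, h₁.cons_cons a, ?_, ?_, by simp⟩
      · simp only [altOK, h₂, Bool.and_true]
        cases d <;> simp at hab h₄ ⊢ <;> omega
      · rw [List.length_cons, h₃]
        simp [turns, hab]

theorem foldr_max_le {l : List ℕ} {m : ℕ} (h : ∀ x ∈ l, x ≤ m) : l.foldr max 0 ≤ m := by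
  induction l with
  | nil => simp
  | cons a l ih => simp_all

theorem le_foldr_max {l : List ℕ} {x : ℕ} (h : x ∈ l) : x ≤ l.foldr max 0 := by
  induction l with
  | nil => simp at h
  | cons a l ih =>
    rcases List.mem_cons.1 h with rfl | h
    · simp
    · simp [ih h]

theorem las_nil : las [] = 0 := by
  simp [las, List.filter, altOK]

theorem las_cons {a : ℕ} {l : List ℕ} (hl : (a :: l).Nodup) :
    las (a :: l) = turns true a l + 1 := by
  apply le_antisymm
  · apply foldr_max_le
    simp only [List.mem_map, List.mem_filter, List.mem_sublists]
    rintro _ ⟨s, ⟨hs, hd⟩, rfl⟩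
    exact length_le_turns_of_altOK hs hd
  · obtain ⟨c, t, h₁, h₂, h₃, -⟩ := exists_altOK_length_eq (d := true) hl
    rw [← h₃]
    apply le_foldr_max
    simp only [List.mem_map, List.mem_filter, List.mem_sublists]
    exact ⟨_, ⟨h₁, h₂⟩, rfl⟩

theorem las_eq_turns {l : List ℕ} (hl : l.Nodup) (hpos : ∀ x ∈ l, 0 < x) (hne : l ≠ []) :
    las l = turns true 0 l + 1 := by
  match l, hne with
  | a :: l, _ => simp [las_cons hl, turns, hpos a (by simp)]

/-- The values of `turns` over all insertions of a new maximum `m` into `l`. -/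
theorem sum_turns_insert {m : ℕ} (d : Bool) (a : ℕ) (l : List ℕ) (ha : a < m)
    (hl : ∀ x ∈ l, x < m) (g : ℕ → ℕ) :
    (if d then g (turns false a l + 1) else 0) +
      ((l.permutations'Aux m).map fun l' => g (turns d a l')).sum =
    (turns d a l + if d then 1 else 0) * g (turns d a l) + g (turns d a l + 1) +
      (l.length - turns d a l) * g (turns d a l + 2) := by
  induction l generalizing d a g with
  | nil => cases d <;> simp [turns, ha, add_comm]
  | cons b l ih =>
    have hb : b < m := hl b (by simp)
    have hl' : ∀ x ∈ l, x < m := fun x hx => hl x (by simp [hx])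
    have hle := fun d => turns_le_length d b l
    have hbm : ¬ m < b := by omega
    by_cases hab : a < b <;> cases d
    · have := ih true b hb hl' fun x => g (x + 1)
      have h := hle true
      simp [turns, ha, hab, hbm, Function.comp_def] at this ⊢
      linarith
    · have := ih true b hb hl' g
      have h := hle true
      simp [turns, ha, hab, hbm, Function.comp_def, Nat.succ_sub h] at this ⊢
      linarith
    · have := ih false b hb hl' g
      have h := hle false
      simp [turns, ha, hab, hbm, Function.comp_def, Nat.succ_sub h] at this ⊢
      linarith
    · have := ih false b hb hl' fun x => g (x + 1)
      have h := hle false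
      simp [turns, ha, hab, hbm, Function.comp_def] at this ⊢
      linarith

theorem perm_cons_of_mem_permutations'Aux {α : Type*} {a : α} {l l' : List α}
    (h : l' ∈ l.permutations'Aux a) : l'.Perm (a :: l) :=
  List.mem_permutations'.1 <| List.mem_flatMap.2 ⟨l, List.mem_permutations'.2 (.refl l), h⟩

/-- The values of `las` over all insertions of a new maximum `m` into `l`. -/
theorem sum_las_insert {m : ℕ} {l : List ℕ} (hm : 0 < m) (hnd : l.Nodup)
    (hl : ∀ x ∈ l, 0 < x ∧ x < m) (hne : l ≠ []) (g : ℕ → ℕ) :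
    ((l.permutations'Aux m).map fun l' => g (las l')).sum =
      las l * g (las l) + g (las l + 1) + (l.length - las l) * g (las l + 2) := by
  have hcongr : ((l.permutations'Aux m).map fun l' => g (las l')) =
      (l.permutations'Aux m).map fun l' => g (turns true 0 l' + 1) := by
    apply List.map_congr_left
    intro l' hl'
    have hp := perm_cons_of_mem_permutations'Aux hl'
    have hm' : m ∉ l := fun h => (hl m h).2.false
    rw [las_eq_turns (hp.nodup_iff.2 (List.nodup_cons.2 ⟨hm', hnd⟩))]
    · intro x hx
      rcases List.mem_cons.1 (hp.mem_iff.1 hx) with rfl | hx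
      · exact hm
      · exact (hl x hx).1
    · rintro rfl
      simpa using hp.length_eq
  rw [hcongr, las_eq_turns hnd (fun x hx => (hl x hx).1) hne]
  have h := sum_turns_insert true 0 l hm (fun x hx => (hl x hx).2) fun x => g (x + 1)
  match l, hne with
  | b :: t, _ =>
    have hb := (hl b (by simp)).1
    have hle := turns_le_length true b t
    simp [turns, hb, Nat.succ_sub hle] at h ⊢
    linarith

/-- The list `[n, n - 1, …, 1]`. -/
def descList : ℕ → List ℕ
  | 0 => []
  | n + 1 => (n + 1) :: descList n

theorem mem_descList {n x : ℕ} : x ∈ descList n ↔ 0 < x ∧ x ≤ n := by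
  induction n with
  | zero => simp [descList]; omega
  | succ n ih => simp [descList, ih]; omega

theorem nodup_descList (n : ℕ) : (descList n).Nodup := by
  induction n with
  | zero => simp [descList]
  | succ n ih => simp [descList, ih, mem_descList]

theorem length_descList (n : ℕ) : (descList n).length = n := by
  induction n with
  | zero => rfl
  | succ n ih => simp [descList, ih]

theorem nodup_permutations'_descList (n : ℕ) : (descList n).permutations'.Nodup :=
  (List.permutations_perm_permutations' _).nodup_iff.1
    (List.nodup_permutations _ (nodup_descList n))

theorem ofFn_pval_injective (n : ℕ) :
    Function.Injective fun π : Equiv.Perm (Fin n) => List.ofFn fun i : Fin n => pval π (i : ℕ) := by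
  intro π σ h
  ext i
  simpa [pval] using congrFun (List.ofFn_injective h) i

theorem image_ofFn_pval (n : ℕ) :
    (univ.image fun π : Equiv.Perm (Fin n) => List.ofFn fun i : Fin n => pval π (i : ℕ)) =
      (descList n).permutations'.toFinset := by
  apply Finset.eq_of_subset_of_card_le
  · intro l hl
    obtain ⟨π, -, rfl⟩ := Finset.mem_image.1 hl
    rw [List.mem_toFinset, List.mem_permutations', List.perm_ext_iff_of_nodup _ (nodup_descList n)]
    · intro x
      simp only [List.mem_ofFn, mem_descList, pval, Fin.is_lt, dite_true, Fin.eta]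
      constructor
      · rintro ⟨i, rfl⟩
        exact ⟨by omega, (π i).is_lt⟩
      · rintro ⟨h₀, hx⟩
        refine ⟨π.symm ⟨x - 1, by omega⟩, ?_⟩
        simp
        omega
    · rw [List.nodup_ofFn]
      intro i j h
      apply π.injective
      ext
      simpa [pval] using h
  · rw [Finset.card_image_of_injective _ (ofFn_pval_injective n),
      List.toFinset_card_of_nodup (nodup_permutations'_descList n),
      ← (List.permutations_perm_permutations' _).length_eq, List.length_permutations,
      length_descList, Finset.card_univ, Fintype.card_perm, Fintype.card_fin]

theorem anum_eq_countP (n k : ℕ) :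
    anum n k = (descList n).permutations'.countP fun l => las l = k := by
  rw [List.countP_eq_length_filter,
    ← List.toFinset_card_of_nodup ((nodup_permutations'_descList n).filter _),
    List.toFinset_filter, ← image_ofFn_pval, Finset.filter_image,
    Finset.card_image_of_injective _ (ofFn_pval_injective n)]
  simp [anum]

theorem countP_eq_sum_map_ite {α : Type*} (p : α → Prop) [DecidablePred p] (l : List α) :
    (l.countP fun a => p a) = (l.map fun a => if p a then 1 else 0).sum := by
  induction l with
  | nil => simp
  | cons a l ih => simp [List.countP_cons, ih, add_comm]

theorem anum_succ {n : ℕ} (hn : 1 ≤ n) (k : ℕ) :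
    anum (n + 1) (k + 2) =
      (k + 2) * anum n (k + 2) + anum n (k + 1) + (n - k) * anum n k := by
  simp only [anum_eq_countP, descList, List.permutations', List.countP_flatMap,
    Function.comp_def]
  simp only [countP_eq_sum_map_ite, ← List.sum_map_mul_left, ← List.sum_map_add]
  congr 1
  apply List.map_congr_left
  intro l hl
  have hp := List.mem_permutations'.1 hl
  have hlen : l.length = n := hp.length_eq.trans (length_descList n)
  rw [sum_las_insert n.succ_pos (hp.nodup_iff.2 (nodup_descList n)) _ _
    fun j => if j = k + 2 then 1 else 0, hlen]
  · by_cases h₁ : las l = k + 2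
    · simp [h₁]
    by_cases h₂ : las l = k + 1
    · simp [h₂]
    by_cases h₃ : las l = k
    · simp [h₃]
    simp [h₁, h₂, h₃]
  · intro x hx
    have := mem_descList.1 (hp.mem_iff.1 hx)
    omega
  · rintro rfl
    simp at hlen
    omega

theorem anum_zero_right {n : ℕ} (hn : 1 ≤ n) : anum n 0 = 0 := by
  rw [anum_eq_countP, List.countP_eq_zero]
  intro l hl
  have hp := List.mem_permutations'.1 hl
  match l with
  | [] =>
    have := hp.length_eq
    rw [length_descList, List.length_nil] at this
    omega
  | a :: l => simp [las_cons (hp.nodup_iff.2 (nodup_descList n))]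

/-- The numbers `a_k(n)` of permutations of `[n]` whose longest alternating subsequence
has length `k` satisfy the stated recurrence and initial values. -/
theorem stmt7 :
    anum 0 0 = 1 ∧ anum 1 1 = 1 ∧ (∀ k, 1 ≤ k → anum 0 k = 0) ∧
    (∀ n, 1 ≤ n → anum n 0 = 0) ∧
    (∀ n k, 1 ≤ n → 2 ≤ k → k ≤ n →
      anum n k = k * anum (n-1) k + anum (n-1) (k-1) + (n - k + 1) * anum (n-1) (k-2)) := by
  refine ⟨?_, ?_, ?_, fun n hn => anum_zero_right hn, ?_⟩
  · simp [anum_eq_countP, descList, las_nil]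
  · simp [anum_eq_countP, descList, las_cons, turns]
  · intro k hk
    simp [anum_eq_countP, descList, las_nil]
    omega
  · intro n k _ hk hkn
    obtain ⟨k, rfl⟩ := Nat.exists_eq_add_of_le' hk
    obtain ⟨n, rfl⟩ := Nat.exists_eq_add_of_le' (show 1 ≤ n by omega)
    rw [anum_succ (by omega) k]
    rw [show n + 1 - (k + 2) + 1 = n - k by omega]
    simp
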